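/- arXiv:2101.06026 — 2 statements merged into one kernel-verified Lean document; each statement's English description precedes it below -/
import Mathlib

section
/- For all integers n ≥ 2 and 1 ≤ k ≤ n−1, the number of 321-avoiding permutations π of [n] with last entry π_n = k+1 and π^{-1}(k) ≤ k equals the ballot number C_{n−1,k−1}. -/
attribute [local instance] Classical.propDecidable

/-- The maximum drop size of a permutation (0-indexed positions and values). -/
def maxdrop {n : ℕ} (π : Equiv.Perm (Fin n)) : ℕ :=
  Finset.univ.sup fun i : Fin n => (i : ℕ) - (π i : ℕ)

/-- `A(n,k)`: permutations of `[n]` with maximum drop size at most `k`. -/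
def bddA (n k : ℕ) : Finset (Equiv.Perm (Fin n)) :=
  Finset.univ.filter fun π => maxdrop π ≤ k

/-- `S(n,k)`: permutations of `[n]` with `σ i - i ≤ k` for all `i`. -/
def bddS (n k : ℕ) : Finset (Equiv.Perm (Fin n)) :=
  Finset.univ.filter fun π => ∀ i : Fin n, (π i : ℕ) ≤ (i : ℕ) + k

/-- The number of inversions of a permutation. -/
def invStat {n : ℕ} (π : Equiv.Perm (Fin n)) : ℕ :=
  (Finset.univ.filter fun p : Fin n × Fin n => p.1 < p.2 ∧ π p.2 < π p.1).card

/-- The number of left-to-right maxima of a permutation. -/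
def lmaxStat {n : ℕ} (π : Equiv.Perm (Fin n)) : ℕ :=
  (Finset.univ.filter fun i : Fin n => ∀ j, j < i → π j < π i).card

/-- The number of cycles of a permutation, fixed points included. -/
def cycStat {n : ℕ} (π : Equiv.Perm (Fin n)) : ℕ :=
  π.cycleType.card + (Finset.univ.filter fun i => π i = i).card

/-- The sorting index: `σ` has a unique factorization
`σ = (i₁,j₁)(i₂,j₂)⋯(iₘ,jₘ)` into transpositions with `j₁ < j₂ < ⋯ < jₘ` and
`iᵣ < jᵣ` for all `r`, and `sor σ = Σᵣ (jᵣ - iᵣ)`. -/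
noncomputable def sorStat {n : ℕ} (σ : Equiv.Perm (Fin n)) : ℕ :=
  if h : ∃ l : List (Fin n × Fin n),
      (∀ p ∈ l, p.1 < p.2) ∧ l.Chain' (fun p q => p.2 < q.2) ∧
      σ = (l.map fun p => Equiv.swap p.1 p.2).prod
  then (h.choose.map fun p => (p.2 : ℕ) - (p.1 : ℕ)).sum
  else 0

/-- `DIS σ = sor σ⁻¹`. -/
noncomputable def DIS {n : ℕ} (σ : Equiv.Perm (Fin n)) : ℕ := sorStat σ⁻¹

/-- 213-avoiding permutations: no `i < j < l` with `π j < π i < π l`. -/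
def avoids213 {n : ℕ} (π : Equiv.Perm (Fin n)) : Prop :=
  ¬ ∃ i j l : Fin n, i < j ∧ j < l ∧ π j < π i ∧ π i < π l

/-- 132-avoiding permutations: no `i < j < l` with `π i < π l < π j`. -/
def avoids132 {n : ℕ} (π : Equiv.Perm (Fin n)) : Prop :=
  ¬ ∃ i j l : Fin n, i < j ∧ j < l ∧ π i < π l ∧ π l < π j

/-- 321-avoiding permutations: no `i < j < l` with `π i > π j > π l`. -/
def avoids321 {n : ℕ} (π : Equiv.Perm (Fin n)) : Prop :=
  ¬ ∃ i j l : Fin n, i < j ∧ j < l ∧ π l < π j ∧ π j < π i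

/-- The number of descents of a permutation. -/
def desStat {n : ℕ} (π : Equiv.Perm (Fin n)) : ℕ :=
  (Finset.univ.filter fun i : Fin n =>
    ∃ j : Fin n, (j : ℕ) = (i : ℕ) + 1 ∧ π j < π i).card

/-- The number of right-to-left maxima of a permutation. -/
def rmaxStat {n : ℕ} (π : Equiv.Perm (Fin n)) : ℕ :=
  (Finset.univ.filter fun i : Fin n => ∀ j, i < j → π j < π i).card

/-- The number of non-weak excedances before the last position. -/
def vnwStat {N : ℕ} (π : Equiv.Perm (Fin N)) : ℕ :=
  (Finset.univ.filter fun i : Fin N => (i : ℕ) + 1 < N ∧ (π i : ℕ) < (i : ℕ)).card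

/-- `Γ_{n,k}`: sequences of `n` ones (`true`) and `k` negative ones (`false`)
with all partial sums nonnegative. -/
noncomputable def GammaBP (n k : ℕ) : Finset (Fin (n + k) → Bool) :=
  Finset.univ.filter fun a =>
    (Finset.univ.filter fun i => a i = true).card = n ∧
    ∀ m ∈ Finset.range (n + k + 1),
      (Finset.univ.filter fun i : Fin (n + k) => (i : ℕ) < m ∧ a i = false).card ≤
      (Finset.univ.filter fun i : Fin (n + k) => (i : ℕ) < m ∧ a i = true).card

/-- `vpk a`: the number of ones immediately followed by a `-1` that are not the
rightmost one. -/
def vpkStat {N : ℕ} (a : Fin N → Bool) : ℕ :=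
  (Finset.univ.filter fun i : Fin N =>
    a i = true ∧ (∃ j : Fin N, (j : ℕ) = (i : ℕ) + 1 ∧ a j = false) ∧
    ∃ j : Fin N, i < j ∧ a j = true).card

/-- `Γ^u_{n,k}`: elements of `Γ_{n,k}` ending with a one. -/
noncomputable def GammaBPU (n k : ℕ) : Finset (Fin (n + k) → Bool) :=
  (GammaBP n k).filter fun a => ∀ i : Fin (n + k), (i : ℕ) + 1 = n + k → a i = true

/-- `Γ^d_{n,k}`: elements of `Γ_{n,k}` ending with a negative one. -/
noncomputable def GammaBPD (n k : ℕ) : Finset (Fin (n + k) → Bool) :=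
  (GammaBP n k).filter fun a => ∀ i : Fin (n + k), (i : ℕ) + 1 = n + k → a i = false

/-- The transposition `t_{i,j}` of `1`-based positions `i` and `j`. -/
def transp (n i j : ℕ) : Equiv.Perm (Fin n) :=
  if h : i - 1 < n ∧ j - 1 < n then Equiv.swap ⟨i - 1, h.1⟩ ⟨j - 1, h.2⟩ else 1

/-- `Ψ_{i,k} = 1 + sᵢ + sᵢsᵢ₋₁ + ⋯` (with `min i k + 1` terms) in `ℤ[Sₙ]`,
where `sᵢ = (i, i+1)` (1-based). -/
noncomputable def PsiElt (n k i : ℕ) : MonoidAlgebra ℤ (Equiv.Perm (Fin n)) :=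
  ∑ m ∈ Finset.range (min i k + 1),
    MonoidAlgebra.of ℤ (Equiv.Perm (Fin n))
      (((List.range m).map fun r => transp n (i - r) (i - r + 1)).prod)

/-- `Φ_{i,k} = 1 + t_{i,i+1} + t_{i-1,i+1} + ⋯` (with `min i k + 1` terms)
in `ℤ[Sₙ]`. -/
noncomputable def PhiElt (n k i : ℕ) : MonoidAlgebra ℤ (Equiv.Perm (Fin n)) :=
  ∑ m ∈ Finset.range (min i k + 1),
    MonoidAlgebra.of ℤ (Equiv.Perm (Fin n)) (transp n (i + 1 - m) (i + 1))

/-- `[i]_q = 1 + q + ⋯ + q^{i-1}` as an element of `ℤ[q,t]`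
(with `q = X 0`, `t = X 1`). -/
noncomputable def qBracket (i : ℕ) : MvPolynomial (Fin 2) ℤ :=
  ∑ j ∈ Finset.range i, MvPolynomial.X 0 ^ j

/-- Inversions only have bottom value `< j`. -/
def IncFrom {m : ℕ} (j : ℕ) (σ : Equiv.Perm (Fin m)) : Prop :=
  ∀ a b : Fin m, a < b → σ b < σ a → (σ b : ℕ) < j

def insLast {m : ℕ} (j : Fin (m + 1)) (σ : Equiv.Perm (Fin m)) : Equiv.Perm (Fin (m + 1)) :=
  ((finSuccEquiv' (Fin.last m)).trans (Equiv.optionCongr σ)).trans (finSuccEquiv' j).symm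

lemma insLast_last {m : ℕ} (j : Fin (m + 1)) (σ : Equiv.Perm (Fin m)) :
    insLast j σ (Fin.last m) = j := by
  simp [insLast]

lemma insLast_castSucc {m : ℕ} (j : Fin (m + 1)) (σ : Equiv.Perm (Fin m)) (i : Fin m) :
    insLast j σ i.castSucc = j.succAbove (σ i) := by
  have : finSuccEquiv' (Fin.last m) i.castSucc = some i := by
    rw [← Fin.succAbove_last_apply, finSuccEquiv'_succAbove]
  simp [insLast, this]

lemma insLast_bij (m : ℕ) : Function.Bijective
    (fun p : Fin (m + 1) × Equiv.Perm (Fin m) => insLast p.1 p.2) := by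
  rw [Fintype.bijective_iff_injective_and_card]
  constructor
  · rintro ⟨j, σ⟩ ⟨j', σ'⟩ h
    simp only at h
    have h1 : j = j' := by
      rw [← insLast_last j σ, h, insLast_last]
    subst h1
    have h2 : σ = σ' := by
      ext i
      have := congrArg (fun f => f i.castSucc) h
      simp only [insLast_castSucc] at this
      rw [Fin.succAbove_right_injective this]
    rw [h2]
  · simp [Fintype.card_perm, Nat.factorial_succ]

lemma card_filter_ins {m : ℕ} (P : Equiv.Perm (Fin (m + 1)) → Prop) [DecidablePred P] :
    (Finset.univ.filter P).card =
      ∑ j : Fin (m + 1), (Finset.univ.filter fun σ => P (insLast j σ)).card := by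
  simp only [Finset.card_filter]
  rw [← (Equiv.ofBijective _ (insLast_bij m)).sum_comp, Fintype.sum_prod_type]
  rfl

lemma succAbove_val {m : ℕ} (j : Fin (m + 1)) (x : Fin m) :
    (j.succAbove x : ℕ) = if (x : ℕ) < j then (x : ℕ) else x + 1 := by
  simp only [Fin.succAbove, Fin.lt_def, Fin.val_castSucc]
  split_ifs <;> simp

lemma avoids_ins {m : ℕ} (j : Fin (m + 1)) (σ : Equiv.Perm (Fin m)) :
    avoids321 (insLast j σ) ↔ avoids321 σ ∧ IncFrom j σ := by
  constructor
  · intro h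
    constructor
    · rintro ⟨a, b, c, hab, hbc, h1, h2⟩
      refine h ⟨a.castSucc, b.castSucc, c.castSucc, by simpa, by simpa, ?_, ?_⟩
      · simpa [insLast_castSucc] using h1
      · simpa [insLast_castSucc] using h2
    · intro a b hab hba
      by_contra hj
      refine h ⟨a.castSucc, b.castSucc, Fin.last m, by simpa, Fin.castSucc_lt_last b, ?_, ?_⟩
      · rw [insLast_last, insLast_castSucc, Fin.lt_def, succAbove_val]
        split_ifs
        omega
      · simpa [insLast_castSucc] using hba
  · rintro ⟨h1, h2⟩ ⟨a, b, c, hab, hbc, hcb, hba⟩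
    have hb : b < Fin.last m := lt_of_lt_of_le hbc (Fin.le_last c)
    obtain ⟨b, rfl⟩ := Fin.exists_castSucc_eq.2 hb.ne
    obtain ⟨a, rfl⟩ := Fin.exists_castSucc_eq.2 (hab.trans hb).ne
    have hab' : a < b := by simpa using hab
    have hba' : σ b < σ a := by simpa [insLast_castSucc] using hba
    have := h2 a b hab' hba'
    by_cases hc : c = Fin.last m
    · subst hc
      rw [insLast_last, insLast_castSucc, Fin.lt_def, succAbove_val] at hcb
      split_ifs at hcb
      omega
    · obtain ⟨c, rfl⟩ := Fin.exists_castSucc_eq.2 hc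
      exact h1 ⟨a, b, c, hab', by simpa using hbc, by simpa [insLast_castSucc] using hcb, hba'⟩

lemma inc_ins_lt {m : ℕ} (i : Fin (m + 1)) (j : ℕ) (σ : Equiv.Perm (Fin m)) (hij : (i : ℕ) < j)
    (h : IncFrom i σ) : IncFrom j (insLast i σ) := by
  intro a b hab hba
  have ha : a < Fin.last m := lt_of_lt_of_le hab (Fin.le_last b)
  obtain ⟨a, rfl⟩ := Fin.exists_castSucc_eq.2 ha.ne
  by_cases hb : b = Fin.last m
  · subst hb
    rwa [insLast_last]
  · obtain ⟨b, rfl⟩ := Fin.exists_castSucc_eq.2 hb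
    have := h a b (by simpa using hab) (by simpa [insLast_castSucc] using hba)
    rw [insLast_castSucc, succAbove_val]
    split_ifs
    omega

lemma inc_ins_ge {m : ℕ} (i : Fin (m + 1)) (j : ℕ) (σ : Equiv.Perm (Fin m)) (hij : j ≤ (i : ℕ)) :
    IncFrom j (insLast i σ) ↔ (i = Fin.last m ∧ IncFrom j σ) := by
  constructor
  · intro h
    have hi : i = Fin.last m := by
      by_contra hi
      obtain ⟨i', rfl⟩ := Fin.exists_castSucc_eq.2 hi
      have := h (σ.symm i').castSucc (Fin.last m) (Fin.castSucc_lt_last _) (by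
        rw [insLast_last, insLast_castSucc, Fin.lt_def, succAbove_val]
        simp)
      rw [insLast_last] at this
      omega
    refine ⟨hi, ?_⟩
    subst hi
    intro a b hab hba
    have := h a.castSucc b.castSucc (by simpa) (by simpa [insLast_castSucc] using hba)
    simpa [insLast_castSucc] using this
  · rintro ⟨rfl, h⟩ a b hab hba
    have ha : a < Fin.last m := lt_of_lt_of_le hab (Fin.le_last b)
    obtain ⟨a, rfl⟩ := Fin.exists_castSucc_eq.2 ha.ne
    by_cases hb : b = Fin.last m
    · subst hb
      rw [insLast_last] at hba
      exact absurd (Fin.le_last _) (not_le.2 hba)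
    · obtain ⟨b, rfl⟩ := Fin.exists_castSucc_eq.2 hb
      have := h a b (by simpa using hab) (by simpa [insLast_castSucc] using hba)
      simpa [insLast_castSucc] using this

noncomputable def bcount (m j : ℕ) : ℕ :=
  (Finset.univ.filter fun σ : Equiv.Perm (Fin m) => avoids321 σ ∧ IncFrom j σ).card

lemma inc_top {m j : ℕ} (h : m ≤ j) (σ : Equiv.Perm (Fin m)) : IncFrom j σ :=
  fun _ b _ _ => lt_of_lt_of_le (σ b).2 h

lemma bcount_rec (m j : ℕ) :
    bcount (m + 1) j = ∑ i : Fin (m + 1),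
      if (i : ℕ) < j then bcount m i else if i = Fin.last m then bcount m j else 0 := by
  unfold bcount
  rw [card_filter_ins]
  refine Finset.sum_congr rfl fun i _ => ?_
  split_ifs with h1 h2
  · congr 1
    ext σ
    simp only [Finset.mem_filter, Finset.mem_univ, true_and, avoids_ins]
    exact ⟨fun h => h.1, fun h => ⟨h, inc_ins_lt i j σ h1 h.2⟩⟩
  · congr 1
    ext σ
    simp only [Finset.mem_filter, Finset.mem_univ, true_and, avoids_ins]
    rw [inc_ins_ge i j σ (not_lt.1 h1)]
    have : IncFrom i σ := inc_top (by simp [h2]) σ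
    tauto
  · rw [Finset.card_eq_zero, Finset.filter_eq_empty_iff]
    intro σ _
    rw [inc_ins_ge i j σ (not_lt.1 h1)]
    tauto

lemma bcount_rec' (m j : ℕ) (hj : j ≤ m) :
    bcount (m + 1) j = ∑ i ∈ Finset.range (j + 1), bcount m i := by
  rw [bcount_rec, Fin.sum_univ_castSucc]
  have h0 : (if ((Fin.last m : Fin (m+1)) : ℕ) < j then bcount m (Fin.last m : Fin (m+1)) else
      if Fin.last m = Fin.last m then bcount m j else 0) = bcount m j := by
    rw [if_neg (by simpa using hj), if_pos rfl]
  rw [h0, Finset.sum_range_succ]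
  congr 1
  have : ∀ i : Fin m, (if ((i.castSucc : Fin (m+1)) : ℕ) < j then bcount m (i.castSucc : Fin (m+1))
      else if i.castSucc = Fin.last m then bcount m j else 0)
      = (fun x : ℕ => if x < j then bcount m x else 0) (i : ℕ) := by
    intro i
    simp [Fin.castSucc_ne_last]
  rw [Finset.sum_congr rfl fun i _ => this i, Fin.sum_univ_eq_sum_range
    (fun x : ℕ => if x < j then bcount m x else 0) m, ← Finset.sum_filter]
  congr 1
  ext x
  simp
  omega

lemma bcount_top (m : ℕ) : bcount (m + 1) (m + 1) = bcount (m + 1) m := by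
  rw [bcount_rec, bcount_rec' m m le_rfl, ← Fin.sum_univ_eq_sum_range]
  refine Finset.sum_congr rfl fun i _ => ?_
  rw [if_pos i.2]

lemma bcount_zero : bcount 0 0 = 1 := by
  unfold bcount
  rw [Finset.filter_true_of_mem]
  · simp
  · intro σ _
    exact ⟨fun ⟨a, _⟩ => a.elim0, fun a => a.elim0⟩

noncomputable def ballot (m j : ℕ) : ℚ := ((m : ℚ) - j + 1) / (m + 1) * ((m + j).choose j : ℚ)

lemma ballot_step (m j : ℕ) : ballot (m + 1) j + ballot m (j + 1) = ballot (m + 1) (j + 1) := by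
  unfold ballot
  have e1 : m + 1 + j = m + j + 1 := by ring
  have e2 : m + (j + 1) = m + j + 1 := by ring
  have e3 : m + 1 + (j + 1) = m + j + 1 + 1 := by ring
  rw [e1, e2, e3, Nat.choose_succ_succ (m + j + 1) j]
  have h : ((m + j + 1).choose (j + 1) : ℚ) * (j + 1) = (m + j + 1).choose j * (m + 1) := by
    have := Nat.choose_succ_right_eq (m + j + 1) j
    rw [show m + j + 1 - j = m + 1 by omega] at this
    exact_mod_cast this
  have hx : ((m + j + 1).choose j : ℚ) = ((m + j + 1).choose (j + 1) : ℚ) * (j + 1) / (m + 1) := by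
    field_simp
    linarith
  push_cast
  rw [hx]
  have : (m : ℚ) + 1 + 1 ≠ 0 := by positivity
  field_simp
  ring

lemma ballot_sum (m j : ℕ) : ∑ i ∈ Finset.range (j + 1), ballot m i = ballot (m + 1) j := by
  induction j with
  | zero =>
    simp [ballot]
    have h1 : (m : ℚ) + 1 + 1 ≠ 0 := by positivity
    have h2 : (m : ℚ) + 1 ≠ 0 := by positivity
    rw [div_self h1, div_self h2]
  | succ j ih => rw [Finset.sum_range_succ, ih, ballot_step]

lemma ballot_top (m : ℕ) : ballot (m + 1) (m + 1) = ballot (m + 1) m := by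
  rw [← ballot_step]
  simp [ballot]

lemma bcount_eq (m : ℕ) : ∀ j ≤ m, (bcount m j : ℚ) = ballot m j := by
  induction m with
  | zero =>
    intro j hj
    obtain rfl : j = 0 := by omega
    simp [bcount_zero, ballot]
  | succ m ih =>
    have key : ∀ j ≤ m, (bcount (m + 1) j : ℚ) = ballot (m + 1) j := by
      intro j hj
      rw [bcount_rec' m j hj, ← ballot_sum]
      push_cast
      refine Finset.sum_congr rfl fun i hi => ih i ?_
      have := Finset.mem_range.1 hi
      omega
    intro j hj
    rcases Nat.lt_or_ge m j with h | h
    · obtain rfl : j = m + 1 := by omega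
      rw [bcount_top, ballot_top, key m le_rfl]
    · exact key j h

lemma inc_iff {m j : ℕ} (hj : j < m) (σ : Equiv.Perm (Fin m)) (hσ : avoids321 σ) :
    (IncFrom (j + 1) σ ∧ (σ.symm ⟨j, hj⟩ : ℕ) ≤ j) ↔ IncFrom j σ := by
  constructor
  · rintro ⟨h, hp⟩ a b hab hba
    have h1 := h a b hab hba
    by_contra hne
    have hbj : σ b = ⟨j, hj⟩ := Fin.ext (by simp only; omega)
    rw [← hbj, Equiv.symm_apply_apply] at hp
    -- all values `< j` lie before `b`
    have hsub : ((Finset.Iio (σ b)).map σ.symm.toEmbedding) ⊆ (Finset.Iio b).erase a := by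
      intro x hx
      simp only [Finset.mem_map, Finset.mem_Iio, Equiv.coe_toEmbedding] at hx
      obtain ⟨y, hy, rfl⟩ := hx
      rw [Finset.mem_erase, Finset.mem_Iio]
      constructor
      · intro he
        rw [← he, Equiv.apply_symm_apply] at hba
        exact absurd hba hy.asymm
      · by_contra hlt
        have hne : b ≠ σ.symm y := by
          intro he
          rw [he, Equiv.apply_symm_apply] at hy
          exact lt_irrefl _ hy
        exact hσ ⟨a, b, σ.symm y, hab, lt_of_le_of_ne (not_lt.1 hlt) hne, by simpa using hy, hba⟩
    have hc := Finset.card_le_card hsub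
    rw [Finset.card_map, Finset.card_erase_of_mem (Finset.mem_Iio.2 hab), Fin.card_Iio,
      Fin.card_Iio, hbj] at hc
    simp only at hc
    have : (a : ℕ) < b := hab
    omega
  · intro h
    refine ⟨fun a b hab hba => (h a b hab hba).trans (Nat.lt_succ_self j), ?_⟩
    have hsub : ((Finset.Iio (σ.symm ⟨j, hj⟩)).map σ.toEmbedding) ⊆ Finset.Iio ⟨j, hj⟩ := by
      intro x hx
      simp only [Finset.mem_map, Finset.mem_Iio, Equiv.coe_toEmbedding] at hx
      obtain ⟨y, hy, rfl⟩ := hx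
      rw [Finset.mem_Iio]
      by_contra hlt
      have hne : σ y ≠ ⟨j, hj⟩ := by
        intro he
        rw [← he, Equiv.symm_apply_apply] at hy
        exact lt_irrefl _ hy
      have := h y _ hy (by
        rw [Equiv.apply_symm_apply]
        exact lt_of_le_of_ne (not_lt.1 hlt) hne.symm)
      simp at this
    have hc := Finset.card_le_card hsub
    rwa [Finset.card_map, Fin.card_Iio, Fin.card_Iio] at hc

lemma ins_symm {m j : ℕ} (hj : j < m) (σ : Equiv.Perm (Fin m)) (h1 : j + 1 < m + 1)
    (h2 : j < m + 1) :
    ((insLast ⟨j + 1, h1⟩ σ)⁻¹ ⟨j, h2⟩ : Fin (m + 1)) = (σ.symm ⟨j, hj⟩).castSucc := by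
  rw [Equiv.Perm.inv_eq_iff_eq, insLast_castSucc, Equiv.apply_symm_apply]
  apply Fin.ext
  rw [succAbove_val]
  simp

lemma main_count (m j : ℕ) (hj : j < m) (h2 : j < m + 1) :
    (Finset.univ.filter fun π : Equiv.Perm (Fin (m + 1)) =>
        avoids321 π ∧ (π (Fin.last m) : ℕ) = j + 1 ∧
          (π⁻¹ ⟨j, h2⟩ : ℕ) + 1 ≤ j + 1).card = bcount m j := by
  rw [card_filter_ins, Finset.sum_eq_single ⟨j + 1, by omega⟩]
  · unfold bcount
    congr 1
    ext σ
    simp only [Finset.mem_filter, Finset.mem_univ, true_and, avoids_ins, insLast_last]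
    rw [ins_symm hj]
    simp only [Fin.val_castSucc, Nat.add_le_add_iff_right]
    constructor
    · rintro ⟨⟨h1, h2⟩, h3⟩
      exact ⟨h1, (inc_iff hj σ h1).1 ⟨h2, h3⟩⟩
    · rintro ⟨h1, h2⟩
      have := (inc_iff hj σ h1).2 h2
      exact ⟨⟨h1, this.1⟩, this.2⟩
  · intro i _ hi
    rw [Finset.card_eq_zero, Finset.filter_eq_empty_iff]
    intro σ _ h
    rw [insLast_last] at h
    exact hi (Fin.ext h.2.1)
  · simp

/-- the number of 321-avoiding `π ∈ Sₙ` with last entry `k+1` and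
`π⁻¹(k) ≤ k` is `C_{n-1,k-1} = ((n-k+1)/n)·binom(n+k-2,k-1)` (all 1-based;
in 0-based terms the last entry is `k` and the position of the value `k-1`,
plus one, is at most `k`). -/
theorem stmt12 (n k : ℕ) (hn : 2 ≤ n) (hk1 : 1 ≤ k) (hk2 : k ≤ n - 1) :
    (((Finset.univ.filter fun π : Equiv.Perm (Fin n) =>
        avoids321 π ∧ (π ⟨n - 1, by omega⟩ : ℕ) = k ∧
          (π⁻¹ ⟨k - 1, by omega⟩ : ℕ) + 1 ≤ k)).card : ℚ) =
      ((n : ℚ) - (k : ℚ) + 1) / (n : ℚ) * ((n + k - 2).choose (k - 1) : ℚ) := by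
  obtain ⟨m, rfl⟩ : ∃ m, n = m + 1 := ⟨n - 1, by omega⟩
  obtain ⟨j, rfl⟩ : ∃ j, k = j + 1 := ⟨k - 1, by omega⟩
  have hj : j < m := by omega
  have h := main_count m j hj (by omega)
  have hb := bcount_eq m j hj.le
  rw [← h] at hb
  have e : m + 1 + (j + 1) - 2 = m + j := by omega
  refine Eq.trans hb ?_
  unfold ballot
  rw [e]
  simp only [Nat.add_sub_cancel]
  push_cast
  ring
end

section
/- For all integers n ≥ 1, 0 ≤ k ≤ n, and every m ≥ 0, the number of permutations π ∈ A_{n,k}(213) with des(π) = m equals the number of sequences a ∈ Γ_{n,k} with vpk(a) = m. -/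
attribute [local instance] Classical.propDecidable

section Aux

theorem card_word_split {L : ℕ} (P : (Fin (L + 1) → Bool) → Prop)
    [DecidablePred P] :
    (Finset.univ.filter P).card =
      (Finset.univ.filter fun a : Fin L → Bool =>
        P (Fin.snoc (α := fun _ => Bool) a true)).card +
      (Finset.univ.filter fun a : Fin L → Bool =>
        P (Fin.snoc (α := fun _ => Bool) a false)).card := by
  simp only [Finset.card_filter]
  rw [← (Fin.snocEquiv (fun _ : Fin (L + 1) => Bool)).sum_comp]
  rw [Fintype.sum_prod_type, Fintype.sum_bool]
  rfl

/-- number of letters `b` among the first `m` letters -/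
noncomputable def cntW {L : ℕ} (a : Fin L → Bool) (m : ℕ) (b : Bool) : ℕ :=
  (Finset.univ.filter fun i : Fin L => (i : ℕ) < m ∧ a i = b).card

theorem cntW_snoc {L : ℕ} (a : Fin L → Bool) (x : Bool) (m : ℕ) (b : Bool) :
    cntW (Fin.snoc (α := fun _ => Bool) a x) m b =
      cntW a m b + if L < m ∧ x = b then 1 else 0 := by
  unfold cntW
  simp only [Finset.card_filter]
  rw [Fin.sum_univ_castSucc]
  simp

theorem cntW_ge {L : ℕ} (a : Fin L → Bool) (m : ℕ) (hm : L ≤ m) (b : Bool) :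
    cntW a m b = cntW a L b := by
  unfold cntW
  congr 1
  ext i
  simp
  omega

theorem cntW_total {L : ℕ} (a : Fin L → Bool) :
    cntW a L true + cntW a L false = L := by
  induction L with
  | zero => simp [cntW]
  | succ L ih =>
    rw [← Fin.snoc_init_self (α := fun _ => Bool) a, cntW_snoc, cntW_snoc,
      cntW_ge _ (L + 1) (by omega), cntW_ge _ (L + 1) (by omega)]
    have := ih (Fin.init (α := fun _ => Bool) a)
    cases a (Fin.last L) <;> simp <;> omega

/-- ballot words with `n` ones -/
def GoodW {L : ℕ} (a : Fin L → Bool) (n : ℕ) : Prop :=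
  cntW a L true = n ∧ ∀ m, m ≤ L → cntW a m false ≤ cntW a m true

theorem goodW_snoc_true {L : ℕ} (a : Fin L → Bool) (n : ℕ) :
    GoodW (Fin.snoc (α := fun _ => Bool) a true) (n + 1) ↔ GoodW a n := by
  unfold GoodW
  simp only [cntW_snoc]
  rw [cntW_ge _ (L + 1) (by omega)]
  constructor
  · rintro ⟨h1, h2⟩
    refine ⟨by simpa using h1, fun m hm => ?_⟩
    have := h2 m (by omega)
    simpa [show ¬ L < m by omega] using this
  · rintro ⟨h1, h2⟩
    refine ⟨by simpa using h1, fun m hm => ?_⟩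
    by_cases h : m ≤ L
    · simpa [show ¬ L < m by omega] using h2 m h
    · have h3 := h2 L le_rfl
      rw [cntW_ge _ m (by omega), cntW_ge _ m (by omega)]
      simp
      omega

theorem goodW_snoc_false {L : ℕ} (a : Fin L → Bool) (n : ℕ) :
    GoodW (Fin.snoc (α := fun _ => Bool) a false) n ↔ GoodW a n ∧ L + 1 ≤ 2 * n := by
  unfold GoodW
  simp only [cntW_snoc]
  rw [cntW_ge _ (L + 1) (by omega)]
  have ht := cntW_total a
  constructor
  · rintro ⟨h1, h2⟩
    have h1' : cntW a L true = n := by simpa using h1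
    refine ⟨⟨h1', fun m hm => ?_⟩, ?_⟩
    · have := h2 m (by omega)
      simpa [show ¬ L < m by omega] using this
    · have := h2 (L + 1) le_rfl
      rw [cntW_ge _ (L + 1) (by omega), cntW_ge _ (L + 1) (by omega)] at this
      simp at this
      omega
  · rintro ⟨⟨h1, h2⟩, h3⟩
    refine ⟨by simpa using h1, fun m hm => ?_⟩
    by_cases h : m ≤ L
    · simpa [show ¬ L < m by omega] using h2 m h
    · rw [cntW_ge _ m (by omega), cntW_ge _ m (by omega)]
      simp
      split_ifs <;> omega

/-- number of peaks -/
def pkStat {N : ℕ} (a : Fin N → Bool) : ℕ :=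
  (Finset.univ.filter fun i : Fin N =>
    a i = true ∧ (∃ j : Fin N, (j : ℕ) = (i : ℕ) + 1 ∧ a j = false)).card

theorem vpk_snoc_true {L : ℕ} (a : Fin L → Bool) :
    vpkStat (Fin.snoc (α := fun _ => Bool) a true) = pkStat a := by
  unfold vpkStat pkStat
  simp only [Finset.card_filter]
  rw [Fin.sum_univ_castSucc]
  simp only [Fin.exists_fin_succ', Fin.snoc_castSucc, Fin.snoc_last]
  simp [Fin.castSucc_lt_last]
  intro i _
  omega

theorem vpk_snoc_false {L : ℕ} (a : Fin L → Bool) :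
    vpkStat (Fin.snoc (α := fun _ => Bool) a false) = vpkStat a := by
  unfold vpkStat
  simp only [Finset.card_filter]
  rw [Fin.sum_univ_castSucc]
  simp only [Fin.exists_fin_succ', Fin.snoc_castSucc, Fin.snoc_last]
  simp
  congr 1
  ext i
  simp
  intro _ j hj _ h
  have := j.isLt
  have : (i : ℕ) < j := hj
  omega

theorem pk_snoc_true {L : ℕ} (a : Fin L → Bool) :
    pkStat (Fin.snoc (α := fun _ => Bool) a true) = pkStat a := by
  unfold pkStat
  simp only [Finset.card_filter]
  rw [Fin.sum_univ_castSucc]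
  simp only [Fin.exists_fin_succ', Fin.snoc_castSucc, Fin.snoc_last]
  simp
  intro i
  omega

theorem pk_snoc_false {L : ℕ} (a : Fin L → Bool) (h : 1 ≤ cntW a L true) :
    pkStat (Fin.snoc (α := fun _ => Bool) a false) = vpkStat a + 1 := by
  have hne : (Finset.univ.filter fun i : Fin L => a i = true).Nonempty := by
    rw [← Finset.card_pos]
    unfold cntW at h
    simpa using h
  obtain ⟨i0, h0, hmax⟩ := Finset.exists_max_image _ (fun i : Fin L => i) hne
  simp at h0 hmax
  rw [← vpk_snoc_false]
  unfold pkStat vpkStat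
  have key : (Finset.univ.filter fun i : Fin (L + 1) =>
      Fin.snoc (α := fun _ => Bool) a false i = true ∧
      (∃ j : Fin (L + 1), (j : ℕ) = (i : ℕ) + 1 ∧
        Fin.snoc (α := fun _ => Bool) a false j = false)) =
      insert i0.castSucc (Finset.univ.filter fun i : Fin (L + 1) =>
        Fin.snoc (α := fun _ => Bool) a false i = true ∧
        (∃ j : Fin (L + 1), (j : ℕ) = (i : ℕ) + 1 ∧
          Fin.snoc (α := fun _ => Bool) a false j = false) ∧
        ∃ j : Fin (L + 1), i < j ∧ Fin.snoc (α := fun _ => Bool) a false j = true) := by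
    ext i
    simp only [Finset.mem_filter, Finset.mem_univ, true_and, Finset.mem_insert]
    constructor
    · rintro ⟨h1, h2⟩
      by_cases hi : i = i0.castSucc
      · exact Or.inl hi
      · refine Or.inr ⟨h1, h2, i0.castSucc, ?_, by simpa using h0⟩
        induction i using Fin.lastCases with
        | last => simp at h1
        | cast i =>
          simp at h1 hi ⊢
          exact lt_of_le_of_ne (hmax i h1) hi
    · rintro (rfl | ⟨h1, h2, _⟩)
      · refine ⟨by simpa using h0, i0.succ, by simp, ?_⟩
        by_contra hc
        simp only [Bool.not_eq_false] at hc
        generalize hj : i0.succ = j at hc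
        induction j using Fin.lastCases with
        | last => simp at hc
        | cast j =>
          simp at hc
          have h3 := hmax j hc
          have h4 := congrArg Fin.val hj
          have h5 : (j : ℕ) ≤ i0 := h3
          simp at h4
          omega
      · exact ⟨h1, h2⟩
  rw [key, Finset.card_insert_of_notMem]
  simp only [Finset.mem_filter, Finset.mem_univ, true_and, not_and, not_exists]
  intro _ _ j hj hc
  induction j using Fin.lastCases with
  | last => simp at hc
  | cast j =>
    simp at hc hj
    exact absurd (hmax j hc) (not_le.mpr hj)

noncomputable def Xw (L n m : ℕ) : ℕ :=
  (Finset.univ.filter fun a : Fin L → Bool => GoodW a n ∧ vpkStat a = m).card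

noncomputable def Yw (L n m : ℕ) : ℕ :=
  (Finset.univ.filter fun a : Fin L → Bool => GoodW a n ∧ pkStat a = m).card

theorem Xw_succ (L n m : ℕ) :
    Xw (L + 1) (n + 1) m = Yw L n m + if L + 1 ≤ 2 * (n + 1) then Xw L (n + 1) m else 0 := by
  unfold Xw Yw
  rw [card_word_split]
  simp only [goodW_snoc_true, goodW_snoc_false, vpk_snoc_true, vpk_snoc_false]
  split_ifs with h <;> simp [h]

theorem Yw_succ_zero (L n : ℕ) :
    Yw (L + 1) (n + 1) 0 = Yw L n 0 := by
  unfold Yw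
  rw [card_word_split]
  simp only [goodW_snoc_true, goodW_snoc_false, pk_snoc_true]
  rw [Nat.add_eq_left, Finset.card_eq_zero, Finset.filter_eq_empty_iff]
  rintro a - ⟨⟨h1, _⟩, h2⟩
  rw [pk_snoc_false a (by have := h1.1; omega)] at h2
  omega

theorem Yw_succ_succ (L n m : ℕ) :
    Yw (L + 1) (n + 1) (m + 1) =
      Yw L n (m + 1) + if L + 1 ≤ 2 * (n + 1) then Xw L (n + 1) m else 0 := by
  unfold Xw Yw
  rw [card_word_split]
  simp only [goodW_snoc_true, goodW_snoc_false, pk_snoc_true]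
  congr 1
  have : ∀ a : Fin L → Bool, ((GoodW a (n + 1) ∧ L + 1 ≤ 2 * (n + 1)) ∧
      pkStat (Fin.snoc (α := fun _ => Bool) a false) = m + 1) ↔
      ((GoodW a (n + 1) ∧ vpkStat a = m) ∧ L + 1 ≤ 2 * (n + 1)) := by
    intro a
    constructor
    · rintro ⟨⟨h1, h3⟩, h2⟩
      rw [pk_snoc_false a (by have := h1.1; omega)] at h2
      exact ⟨⟨h1, by omega⟩, h3⟩
    · rintro ⟨⟨h1, h2⟩, h3⟩
      rw [pk_snoc_false a (by have := h1.1; omega)]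
      exact ⟨⟨h1, h3⟩, by omega⟩
  simp only [this]
  split_ifs with h <;> simp [h]

theorem Xw_short (L n m : ℕ) (h : L < n) : Xw L n m = 0 := by
  unfold Xw
  rw [Finset.card_eq_zero, Finset.filter_eq_empty_iff]
  rintro a - ⟨h1, _⟩
  have := cntW_total a
  have := h1.1
  omega

theorem Yw_base (k m : ℕ) : Yw k 0 m = if k = 0 ∧ m = 0 then 1 else 0 := by
  unfold Yw
  rcases Nat.eq_zero_or_pos k with rfl | hk
  · by_cases hm : m = 0
    · subst hm
      simp [GoodW, cntW, pkStat]
    · simp [GoodW, cntW, pkStat, hm, Ne.symm hm]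
  · rw [if_neg (by omega), Finset.card_eq_zero, Finset.filter_eq_empty_iff]
    rintro a - ⟨h1, _⟩
    have := cntW_total a
    have := h1.1
    have := h1.2 k le_rfl
    omega

theorem Gamma_eq (n k m : ℕ) :
    ((GammaBP n k).filter fun a => vpkStat a = m).card = Xw (n + k) n m := by
  unfold Xw GammaBP GoodW cntW
  rw [Finset.filter_filter]
  congr 1
  ext a
  simp

/-! Permutations -/

def insP {n : ℕ} (v : Fin (n + 1)) (p : Equiv.Perm (Fin n)) : Equiv.Perm (Fin (n + 1)) :=
  (finSuccEquivLast.trans (Equiv.optionCongr p)).trans (finSuccEquiv' v).symm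

@[simp] theorem insP_castSucc {n : ℕ} (v : Fin (n + 1)) (p : Equiv.Perm (Fin n)) (i : Fin n) :
    insP v p i.castSucc = v.succAbove (p i) := by
  simp [insP]

@[simp] theorem insP_last {n : ℕ} (v : Fin (n + 1)) (p : Equiv.Perm (Fin n)) :
    insP v p (Fin.last n) = v := by
  simp [insP]

theorem insP_bij (n : ℕ) : Function.Bijective
    (fun x : Fin (n + 1) × Equiv.Perm (Fin n) => insP x.1 x.2) := by
  rw [Fintype.bijective_iff_injective_and_card]
  constructor
  · rintro ⟨v, p⟩ ⟨w, q⟩ h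
    simp only at h
    have h1 : v = w := by
      have := congrArg (fun f => f (Fin.last n)) h
      simpa using this
    subst h1
    have : p = q := by
      ext i
      have := congrArg (fun f => f i.castSucc) h
      simp at this
      rw [this]
    rw [this]
  · simp [Fintype.card_perm, Nat.factorial_succ]

theorem card_perm_split {n : ℕ} (P : Equiv.Perm (Fin (n + 1)) → Prop) (v : Fin (n + 1)) :
    (Finset.univ.filter fun p => P p ∧ p (Fin.last n) = v).card =
      (Finset.univ.filter fun p : Equiv.Perm (Fin n) => P (insP v p)).card := by
  symm
  refine Finset.card_bij (fun p _ => insP v p) ?_ ?_ ?_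
  · intro p hp
    simpa using hp
  · intro p _ q _ h
    have := (insP_bij n).1 (a₁ := (v, p)) (a₂ := (v, q)) h
    simpa using this
  · intro q hq
    obtain ⟨⟨w, p⟩, rfl⟩ := (insP_bij n).2 q
    simp at hq
    obtain ⟨h1, rfl⟩ := hq
    exact ⟨p, by simpa using h1, rfl⟩

theorem exists_insP {n : ℕ} (q : Equiv.Perm (Fin (n + 1))) : ∃ v p, q = insP v p := by
  obtain ⟨⟨w, p⟩, rfl⟩ := (insP_bij n).2 q
  exact ⟨w, p, rfl⟩

theorem succAbove_val_s14 {n : ℕ} (v : Fin (n + 1)) (i : Fin n) :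
    (v.succAbove i : ℕ) = if (i : ℕ) < v then (i : ℕ) else i + 1 := by
  simp only [Fin.succAbove, Fin.lt_def]
  split_ifs <;> simp_all

theorem avoids_insP {n : ℕ} (v : Fin (n + 2)) (p : Equiv.Perm (Fin (n + 1))) :
    avoids213 (insP v p) ↔ avoids213 p ∧ (v : ℕ) ≤ p (Fin.last n) + 1 := by
  unfold avoids213
  constructor
  · intro h
    refine ⟨?_, ?_⟩
    · rintro ⟨i, j, l, h1, h2, h3, h4⟩
      exact h ⟨i.castSucc, j.castSucc, l.castSucc, by simpa, by simpa, by simpa, by simpa⟩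
    · by_contra hc
      push Not at hc
      have hv := v.isLt
      let y : Fin (n + 1) := ⟨p (Fin.last n) + 1, by omega⟩
      refine h ⟨(p.symm y).castSucc, (Fin.last n).castSucc, Fin.last (n + 1), ?_, ?_, ?_, ?_⟩
      · simp only [Fin.castSucc_lt_castSucc_iff]
        refine lt_of_le_of_ne (Fin.le_last _) ?_
        intro he
        have : y = p (Fin.last n) := by rw [← he]; simp
        have := congrArg Fin.val this
        simp [y] at this
      · exact Fin.castSucc_lt_last _
      · rw [insP_castSucc, insP_castSucc, Fin.succAbove_lt_succAbove_iff, Equiv.apply_symm_apply,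
          Fin.lt_def]
        exact Nat.lt_succ_self _
      · simp only [insP_castSucc, insP_last, Equiv.apply_symm_apply, Fin.lt_def, succAbove_val_s14]
        have : (y : ℕ) = p (Fin.last n) + 1 := rfl
        split_ifs <;> omega
  · rintro ⟨h, hv⟩ ⟨i, j, l, h1, h2, h3, h4⟩
    have hj : j ≠ Fin.last _ := fun e => by
      subst e
      exact absurd h2 (not_lt.mpr (Fin.le_last _))
    have hi : i ≠ Fin.last _ := fun e => by
      subst e
      exact absurd h1 (not_lt.mpr (Fin.le_last _))
    obtain ⟨i, rfl⟩ := Fin.exists_castSucc_eq.mpr hi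
    obtain ⟨j, rfl⟩ := Fin.exists_castSucc_eq.mpr hj
    simp at h1 h3
    induction l using Fin.lastCases with
    | cast l =>
      simp at h2 h4
      exact h ⟨i, j, l, h1, h2, h3, h4⟩
    | last =>
      simp only [insP_castSucc, insP_last, Fin.lt_def, succAbove_val_s14] at h4
      have hil : i ≠ Fin.last _ := fun e => by
        subst e
        exact absurd h1 (not_lt.mpr (Fin.le_last _))
      have hne : (p i : ℕ) ≠ p (Fin.last n) := fun e => hil (p.injective (Fin.ext e))
      have hlt : p i < p (Fin.last n) := by
        rw [Fin.lt_def]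
        split_ifs at h4 <;> omega
      refine h ⟨i, j, Fin.last n, h1, ?_, h3, hlt⟩
      refine lt_of_le_of_ne (Fin.le_last _) ?_
      rintro rfl
      exact absurd (h3.trans hlt) (lt_irrefl _)

theorem des_insP {n : ℕ} (v : Fin (n + 2)) (p : Equiv.Perm (Fin (n + 1))) :
    desStat (insP v p) = desStat p + if (v : ℕ) ≤ p (Fin.last n) then 1 else 0 := by
  unfold desStat
  simp only [Finset.card_filter]
  rw [Fin.sum_univ_castSucc, Fin.sum_univ_castSucc, Fin.sum_univ_castSucc (n := n)]
  simp only [Fin.exists_fin_succ', insP_castSucc, insP_last, Fin.succAbove_lt_succAbove_iff]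
  have e2 : ∀ i : Fin n, ((i : ℕ) = n + 1) = False := by
    intro i; have := i.isLt; simp; omega
  have e3 : ∀ i : Fin n, ((i : ℕ) = n + 1 + 1) = False := by
    intro i; have := i.isLt; simp; omega
  have e4 : v < v.succAbove (p (Fin.last n)) ↔ (v : ℕ) ≤ p (Fin.last n) := by
    rw [Fin.lt_def, succAbove_val_s14]
    split_ifs <;> omega
  have e5 : ∀ i : Fin n, (n = (i : ℕ)) = False := by
    intro i; have := i.isLt; simp; omega
  have e6 : (n = n + 1 + 1) = False := by simp; omega
  simp [e2, e3, e4, e5, e6]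

theorem drop_le {n : ℕ} (p : Equiv.Perm (Fin (n + 1))) (h : avoids213 p) (i : Fin (n + 1)) :
    (i : ℕ) + p (Fin.last n) ≤ n + p i := by
  induction n with
  | zero => 
    have := Fin.fin_one_eq_zero i
    subst this
    simp
  | succ n ih =>
    obtain ⟨v, q, rfl⟩ := exists_insP p
    rw [avoids_insP] at h
    induction i using Fin.lastCases with
    | last => simp
    | cast i =>
      have := ih q h.1 i
      have h2 := h.2
      simp only [insP_castSucc, insP_last, succAbove_val_s14, Fin.val_castSucc]
      split_ifs <;> omega

theorem maxdrop_iff {n : ℕ} (p : Equiv.Perm (Fin (n + 1))) (h : avoids213 p) (k : ℕ) :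
    maxdrop p ≤ k ↔ n ≤ k + p (Fin.last n) := by
  unfold maxdrop
  rw [Finset.sup_le_iff]
  constructor
  · intro h1
    have := h1 (Fin.last n) (Finset.mem_univ _)
    simp at this
    omega
  · intro h1 i _
    have := drop_le p h i
    omega

noncomputable def Xp (n k m : ℕ) : ℕ :=
  (Finset.univ.filter fun p : Equiv.Perm (Fin (n + 1)) =>
    avoids213 p ∧ n ≤ k + p (Fin.last n) ∧ desStat p = m).card

noncomputable def Yp (n k m : ℕ) : ℕ :=
  (Finset.univ.filter fun p : Equiv.Perm (Fin (n + 1)) =>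
    avoids213 p ∧ n = k + p (Fin.last n) ∧ desStat p = m).card

theorem A_eq (n k m : ℕ) :
    ((bddA (n + 1) k).filter fun π => avoids213 π ∧ desStat π = m).card = Xp n k m := by
  unfold Xp bddA
  rw [Finset.filter_filter]
  congr 1
  ext p
  simp only [Finset.mem_filter, Finset.mem_univ, true_and]
  constructor
  · rintro ⟨h1, h2, h3⟩
    exact ⟨h2, (maxdrop_iff p h2 k).1 h1, h3⟩
  · rintro ⟨h2, h1, h3⟩
    exact ⟨(maxdrop_iff p h2 k).2 h1, h2, h3⟩

theorem Xp_zero (n m : ℕ) : Xp n 0 m = Yp n 0 m := by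
  unfold Xp Yp
  congr 1
  ext p
  have := (p (Fin.last n)).isLt
  simp
  intro _ _
  omega

theorem Xp_succ (n k m : ℕ) : Xp n (k + 1) m = Yp n (k + 1) m + Xp n k m := by
  unfold Xp Yp
  rw [← Finset.card_union_of_disjoint]
  · congr 1
    ext p
    simp only [Finset.mem_filter, Finset.mem_univ, true_and, Finset.mem_union]
    constructor
    · rintro ⟨h1, h2, h3⟩
      by_cases h : n = k + 1 + p (Fin.last n)
      · exact Or.inl ⟨h1, h, h3⟩
      · exact Or.inr ⟨h1, by omega, h3⟩
    · rintro (⟨h1, h2, h3⟩ | ⟨h1, h2, h3⟩)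
      · exact ⟨h1, by omega, h3⟩
      · exact ⟨h1, by omega, h3⟩
  · rw [Finset.disjoint_filter]
    rintro p _ ⟨_, h1, _⟩ ⟨_, h2, _⟩
    omega

theorem Yp_base (k m : ℕ) : Yp 0 k m = if k = 0 ∧ m = 0 then 1 else 0 := by
  unfold Yp
  have h1 : ∀ p : Equiv.Perm (Fin 1), avoids213 p := by
    rintro p ⟨i, j, l, h, _⟩
    exact absurd h (by simp [Subsingleton.elim i j])
  have h2 : ∀ p : Equiv.Perm (Fin 1), desStat p = 0 := by
    intro p
    unfold desStat
    simp
  have h3 : ∀ p : Equiv.Perm (Fin 1), ((p (Fin.last 0) : Fin 1) : ℕ) = 0 := by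
    intro p
    omega
  simp only [h1, h2, h3]
  by_cases hk : k = 0 <;> by_cases hm : m = 0 <;>
    simp [hk, hm, eq_comm (a := 0)]

theorem Yp_long (n k m : ℕ) (h : n < k) : Yp n k m = 0 := by
  unfold Yp
  rw [Finset.card_eq_zero, Finset.filter_eq_empty_iff]
  rintro p - ⟨_, h1, _⟩
  omega

theorem Yp_step (n k m : ℕ) (hk : k ≤ n + 1) :
    Yp (n + 1) k m = (Finset.univ.filter fun p : Equiv.Perm (Fin (n + 1)) =>
      avoids213 p ∧ n ≤ k + p (Fin.last n) ∧
      desStat p + (if n + 1 ≤ k + p (Fin.last n) then 1 else 0) = m).card := by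
  have h := card_perm_split (fun p : Equiv.Perm (Fin (n + 2)) => avoids213 p ∧ desStat p = m)
    ⟨n + 1 - k, by omega⟩
  simp only [avoids_insP, des_insP] at h
  unfold Yp
  convert h using 2
  · ext p
    simp only [Finset.mem_filter, Finset.mem_univ, true_and, Fin.ext_iff]
    constructor
    · rintro ⟨h1, h2, h3⟩
      exact ⟨⟨h1, h3⟩, by omega⟩
    · rintro ⟨⟨h1, h3⟩, h2⟩
      exact ⟨h1, by omega, h3⟩
  · ext p
    simp only [Finset.mem_filter, Finset.mem_univ, true_and, and_assoc]
    have e1 : n ≤ k + p (Fin.last n) ↔ n + 1 - k ≤ p (Fin.last n) + 1 := by omega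
    have e2 : n + 1 ≤ k + p (Fin.last n) ↔ n + 1 - k ≤ p (Fin.last n) := by omega
    simp only [e1, e2]

theorem Yp_succ_zero_left (n m : ℕ) : Yp (n + 1) 0 m = Yp n 0 m := by
  rw [Yp_step _ _ _ (by omega)]
  unfold Yp
  congr 1
  ext p
  have := (p (Fin.last n)).isLt
  simp only [Finset.mem_filter, Finset.mem_univ, true_and]
  rw [if_neg (by omega)]
  constructor
  · rintro ⟨h1, h2, h3⟩
    exact ⟨h1, by omega, h3⟩
  · rintro ⟨h1, h2, h3⟩
    exact ⟨h1, by omega, h3⟩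

theorem Yp_succ_zero (n k : ℕ) : Yp (n + 1) k 0 = Yp n k 0 := by
  by_cases hk : k ≤ n + 1
  · rw [Yp_step _ _ _ hk]
    unfold Yp
    congr 1
    ext p
    simp only [Finset.mem_filter, Finset.mem_univ, true_and]
    constructor
    · rintro ⟨h1, h2, h3⟩
      split_ifs at h3
      exact ⟨h1, by omega, by omega⟩
    · rintro ⟨h1, h2, h3⟩
      rw [if_neg (by omega)]
      exact ⟨h1, by omega, h3⟩
  · rw [Yp_long _ _ _ (by omega), Yp_long _ _ _ (by omega)]

theorem Yp_succ_succ (n k m : ℕ) :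
    Yp (n + 1) (k + 1) (m + 1) =
      Yp n (k + 1) (m + 1) + if k + 1 ≤ n + 1 then Xp n k m else 0 := by
  by_cases hk : k + 1 ≤ n + 1
  · rw [Yp_step _ _ _ hk, if_pos hk]
    unfold Yp Xp
    rw [← Finset.card_union_of_disjoint]
    · congr 1
      ext p
      simp only [Finset.mem_filter, Finset.mem_univ, true_and, Finset.mem_union]
      constructor
      · rintro ⟨h1, h2, h3⟩
        split_ifs at h3
        · exact Or.inr ⟨h1, by omega, by omega⟩
        · exact Or.inl ⟨h1, by omega, by omega⟩
      · rintro (⟨h1, h2, h3⟩ | ⟨h1, h2, h3⟩)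
        · rw [if_neg (by omega)]
          exact ⟨h1, by omega, h3⟩
        · rw [if_pos (by omega)]
          exact ⟨h1, by omega, by omega⟩
    · rw [Finset.disjoint_filter]
      rintro p _ ⟨_, h1, _⟩ ⟨_, h2, _⟩
      omega
  · rw [Yp_long _ _ _ (by omega), Yp_long _ _ _ (by omega), if_neg hk]

theorem X_of_Y (n : ℕ) (hY : ∀ k m, Yp n k m = Yw (n + k) n m) :
    ∀ k m, k ≤ n + 1 → Xp n k m = Xw (n + 1 + k) (n + 1) m := by
  intro k
  induction k with
  | zero =>
    intro m _
    rw [Xp_zero, hY, Nat.add_zero, Nat.add_zero, Xw_succ, Xw_short _ _ _ (by omega)]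
    simp
  | succ k ih =>
    intro m hk
    rw [Xp_succ, hY, ih m (by omega), show n + 1 + (k + 1) = (n + (k + 1)) + 1 by omega,
      Xw_succ, if_pos (by omega), show n + (k + 1) = n + 1 + k by omega]

theorem Y_eq (n : ℕ) : ∀ k m, Yp n k m = Yw (n + k) n m := by
  induction n with
  | zero =>
    intro k m
    rw [Yp_base, Nat.zero_add, Yw_base]
  | succ n ih =>
    intro k m
    rw [show n + 1 + k = (n + k) + 1 by omega]
    cases m with
    | zero => rw [Yp_succ_zero, Yw_succ_zero, ih]
    | succ m =>
      rw [Yw_succ_succ]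
      cases k with
      | zero =>
        rw [Yp_succ_zero_left, ih, Xw_short _ _ _ (by omega)]
        simp
      | succ k =>
        rw [Yp_succ_succ, ih]
        by_cases h : k + 1 ≤ n + 1
        · rw [if_pos h, if_pos (by omega), X_of_Y n ih k m (by omega),
            show n + (k + 1) = n + 1 + k by omega]
        · rw [if_neg h, if_neg (by omega)]

end Aux

/-- `des` over `A_{n,k}(213)` is equidistributed with `vpk` over
`Γ_{n,k}`. -/
theorem stmt14 (n k : ℕ) (hn : 1 ≤ n) (hk : k ≤ n) (m : ℕ) :
    ((bddA n k).filter fun π => avoids213 π ∧ desStat π = m).card =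
    ((GammaBP n k).filter fun a => vpkStat a = m).card := by
  obtain ⟨n, rfl⟩ : ∃ n0, n = n0 + 1 := ⟨n - 1, by omega⟩
  rw [A_eq, Gamma_eq, X_of_Y n (Y_eq n) k m hk]
end
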